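/- arXiv:math/0411542 — 2 statements merged into one kernel-verified Lean document; each statement's English description precedes it below -/
import Mathlib

section
/- Assume V is finite-dimensional (so that every A_d and every A^¡_d is finite-dimensional). If A is Koszul, then in the formal power series ring ℤ⟦x⟧: (Σ_{d≥0} (−1)^d dim_k A^¡_d · x^d) · (Σ_{d≥0} dim_k A_d · x^d) = 1. -/
set_option linter.unusedSectionVars false

open TensorProduct

noncomputable section Quadratic

variable (k : Type) [Field k] [CharZero k]
variable (V : Type) [AddCommGroup V] [Module k V]

/-- Iterated tensor powers of `V`: `TP k V n = V^{⊗n}` (with `TP k V 0 = k`, `TP k V 1 = V`). -/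
def TP : ℕ → ModuleCat k
  | 0 => ModuleCat.of k k
  | 1 => ModuleCat.of k V
  | (n + 2) => ModuleCat.of k (↥(TP (n + 1)) ⊗[k] V)

/-- `V^{⊗n} ⊗ V ≅ V^{⊗(n+1)}`. -/
def stepEquiv : ∀ n : ℕ, (↥(TP k V n) ⊗[k] V) ≃ₗ[k] ↥(TP k V (n + 1))
  | 0 => TensorProduct.lid k V
  | (n + 1) => LinearEquiv.refl k ↥(TP k V (n + 2))

/-- The concatenation isomorphism `V^{⊗p} ⊗ V^{⊗q} ≅ V^{⊗(p+q)}`. -/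
def concatEquiv : ∀ p q : ℕ, (↥(TP k V p) ⊗[k] ↥(TP k V q)) ≃ₗ[k] ↥(TP k V (p + q))
  | p, 0 => TensorProduct.rid k ↥(TP k V p)
  | p, 1 => stepEquiv k V p
  | p, (q + 2) =>
      (TensorProduct.assoc k ↥(TP k V p) ↥(TP k V (q + 1)) V).symm.trans
        ((TensorProduct.congr (concatEquiv p (q + 1)) (LinearEquiv.refl k V)).trans
          (stepEquiv k V (p + (q + 1))))

/-- Transport of submodules along an equality of tensor-power indices. -/
def castTP {m n : ℕ} (h : m = n) (S : Submodule k ↥(TP k V m)) : Submodule k ↥(TP k V n) :=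
  h ▸ S

/-- For `S ⊆ V^{⊗p}` and `T ⊆ V^{⊗q}`, the subspace `S ⊗ T ⊆ V^{⊗(p+q)}`. -/
def concatSub {p q : ℕ} (S : Submodule k ↥(TP k V p)) (T : Submodule k ↥(TP k V q)) :
    Submodule k ↥(TP k V (p + q)) :=
  Submodule.map (concatEquiv k V p q).toLinearMap
    (LinearMap.range (TensorProduct.map S.subtype T.subtype))

variable (R : Submodule k ↥(TP k V 2))

/-- The subspace `V^{⊗i} ⊗ R ⊗ V^{⊗j}` of `V^{⊗(i+2+j)}`. -/
def relTerm (i j : ℕ) : Submodule k ↥(TP k V (i + 2 + j)) :=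
  castTP k V (by omega)
    (concatSub k V (⊤ : Submodule k ↥(TP k V i)) (concatSub k V R (⊤ : Submodule k ↥(TP k V j))))

/-- The weight-`d` part `Σ_{i=0}^{d−2} V^{⊗i} ⊗ R ⊗ V^{⊗(d−2−i)}` of the ideal generated by `R`,
so that the weight-`d` piece of the quadratic algebra `A = T(V)/(R)` is `A_d = V^{⊗d}/RelOf d`. -/
def RelOf (d : ℕ) : Submodule k ↥(TP k V d) :=
  ⨆ i : Fin (d - 1), castTP k V (by have := i.isLt; omega) (relTerm k V R i (d - 2 - i))

/-- The weight-`d` component of the Koszul dual of `A = T(V)/(R)`: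
`A^¡_0 = k`, `A^¡_1 = V` and `A^¡_d = ⋂_{i=0}^{d−2} V^{⊗i} ⊗ R ⊗ V^{⊗(d−2−i)}` for `d ≥ 2`. -/
def Dual (d : ℕ) : Submodule k ↥(TP k V d) :=
  ⨅ i : Fin (d - 1), castTP k V (by have := i.isLt; omega) (relTerm k V R i (d - 2 - i))

/-- The numerator `A^¡_d ⊗ V^{⊗(ρ−d)}` of the `d`-th term of the Koszul complex of weight `ρ`
(the `d`-th term of the Koszul complex is `A^¡_d ⊗ A_{ρ−d} = Kt ρ d / Kr ρ d`, with all terms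
realized as subquotients of `V^{⊗ρ}` along the canonical identifications; the differentials are
then all induced by the identity of `V^{⊗ρ}`). -/
def Kt (ρ d : ℕ) : Submodule k ↥(TP k V ρ) :=
  if h : d ≤ ρ then
    castTP k V (by omega) (concatSub k V (Dual k V R d) (⊤ : Submodule k ↥(TP k V (ρ - d))))
  else ⊥

/-- The denominator `A^¡_d ⊗ (RelOf (ρ−d))` of the `d`-th term of the Koszul complex of weight
`ρ`, so that this term is `A^¡_d ⊗ A_{ρ−d} = Kt ρ d / Kr ρ d`. -/
def Kr (ρ d : ℕ) : Submodule k ↥(TP k V ρ) :=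
  if h : d ≤ ρ then
    castTP k V (by omega) (concatSub k V (Dual k V R d) (RelOf k V R (ρ - d)))
  else ⊥

/-- `A = T(V)/(R)` is Koszul: for every weight `ρ ≥ 1` the Koszul complex
`0 → A^¡_ρ → A^¡_{ρ−1} ⊗ A_1 → ⋯ → A^¡_1 ⊗ A_{ρ−1} → A_ρ → 0`
is exact.  Realizing the `d`-th term as the subquotient `Kt ρ d / Kr ρ d` of `V^{⊗ρ}` (with the
differentials induced by the identity of `V^{⊗ρ}`), exactness at the `d`-th term reads
`Kt ρ d ⊓ Kr ρ (d−1) = Kr ρ d ⊔ Kt ρ (d+1)` (at `d = 0` the kernel of the outgoing map is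
everything, whence the `if`). -/
def IsKoszul : Prop :=
  ∀ ρ ≥ 1, ∀ d ≤ ρ,
    Kt k V R ρ d ⊓ (if d = 0 then ⊤ else Kr k V R ρ (d - 1)) =
      Kr k V R ρ d ⊔ Kt k V R ρ (d + 1)

instance finiteDimensional_TP [FiniteDimensional k V] : ∀ n, FiniteDimensional k ↥(TP k V n)
  | 0 => inferInstanceAs (FiniteDimensional k k)
  | 1 => inferInstanceAs (FiniteDimensional k V)
  | n + 2 => by
      have := finiteDimensional_TP (n + 1)
      exact inferInstanceAs (FiniteDimensional k (↥(TP k V (n + 1)) ⊗[k] V))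

theorem finrank_castTP {m n : ℕ} (h : m = n) (S : Submodule k ↥(TP k V m)) :
    Module.finrank k ↥(castTP k V h S) = Module.finrank k ↥S := by
  subst h
  rfl

theorem finrank_concatSub {p q : ℕ} (S : Submodule k ↥(TP k V p))
    (T : Submodule k ↥(TP k V q)) :
    Module.finrank k ↥(concatSub k V S T) = Module.finrank k ↥S * Module.finrank k ↥T := by
  rw [concatSub, LinearEquiv.finrank_map_eq, LinearMap.finrank_range_of_inj,
    Module.finrank_tensorProduct]
  exact TensorProduct.map_injective_of_flat_flat _ _ S.injective_subtype T.injective_subtype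

theorem finrank_Kt {ρ d : ℕ} (h : d ≤ ρ) :
    Module.finrank k ↥(Kt k V R ρ d) =
      Module.finrank k ↥(Dual k V R d) * Module.finrank k ↥(TP k V (ρ - d)) := by
  rw [Kt, dif_pos h, finrank_castTP, finrank_concatSub, finrank_top]

theorem finrank_Kr {ρ d : ℕ} (h : d ≤ ρ) :
    Module.finrank k ↥(Kr k V R ρ d) =
      Module.finrank k ↥(Dual k V R d) * Module.finrank k ↥(RelOf k V R (ρ - d)) := by
  rw [Kr, dif_pos h, finrank_castTP, finrank_concatSub]

/-- The term `A^¡_d ⊗ A_{ρ−d}` of the Koszul complex has dimension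
`dim (Kt ρ d) − dim (Kr ρ d)`. -/
theorem finrank_Dual_mul_finrank_quotient [FiniteDimensional k V] {ρ d : ℕ} (h : d ≤ ρ) :
    (Module.finrank k ↥(Dual k V R d) : ℤ) *
        (Module.finrank k (↥(TP k V (ρ - d)) ⧸ RelOf k V R (ρ - d)) : ℤ) =
      (Module.finrank k ↥(Kt k V R ρ d) : ℤ) - (Module.finrank k ↥(Kr k V R ρ d) : ℤ) := by
  rw [finrank_Kt k V R h, finrank_Kr k V R h,
    ← Submodule.finrank_quotient_add_finrank (RelOf k V R (ρ - d))]
  push_cast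
  ring

/-- If `z d + z (d + 1) = r d + t (d + 1)` for `d ≤ n`, then the partial alternating sums of
`t - r` telescope. -/
theorem alternating_sum_sub_eq (t r z : ℕ → ℤ) (n : ℕ)
    (h : ∀ d ≤ n, z d + z (d + 1) = r d + t (d + 1)) :
    ∑ d ∈ Finset.range (n + 1), (-1) ^ d * (t d - r d) =
      t 0 - z 0 + (-1) ^ n * (t (n + 1) - z (n + 1)) := by
  induction n with
  | zero =>
    have := h 0 le_rfl
    simp only [zero_add, Finset.sum_range_one, pow_zero, one_mul] at this ⊢
    linarith
  | succ n ih =>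
    rw [Finset.sum_range_succ, ih fun d hd => h d (hd.trans n.le_succ), pow_succ]
    linear_combination -(-1 : ℤ) ^ n * h (n + 1) le_rfl

/-- The Euler characteristic of the Koszul complex of weight `ρ ≥ 1` of a Koszul algebra
vanishes. -/
theorem IsKoszul.alternating_sum_eq_zero [FiniteDimensional k V] (hA : IsKoszul k V R)
    {ρ : ℕ} (hρ : 1 ≤ ρ) :
    ∑ d ∈ Finset.range (ρ + 1), (-1 : ℤ) ^ d *
      ((Module.finrank k ↥(Kt k V R ρ d) : ℤ) - (Module.finrank k ↥(Kr k V R ρ d) : ℤ)) = 0 := by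
  have hKt : Kt k V R ρ (ρ + 1) = ⊥ := dif_neg (by omega)
  rw [alternating_sum_sub_eq _ _ (fun d => (Module.finrank k
    ↥(Kt k V R ρ d ⊓ (if d = 0 then ⊤ else Kr k V R ρ (d - 1))) : ℤ)) ρ]
  · rw [hKt, if_pos rfl, inf_top_eq, bot_inf_eq]
    simp
  · intro d hd
    have hsum := Submodule.finrank_sup_add_finrank_inf_eq (Kr k V R ρ d) (Kt k V R ρ (d + 1))
    rw [← hA ρ hρ d hd, inf_comm (Kr k V R ρ d)] at hsum
    rw [if_neg d.succ_ne_zero, Nat.add_sub_cancel]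
    exact_mod_cast hsum

theorem finrank_Dual_zero : Module.finrank k ↥(Dual k V R 0) = 1 := by
  have h : Dual k V R 0 = ⊤ := by
    rw [Dual, iInf_eq_top]
    exact fun i => i.elim0
  rw [h, finrank_top]
  exact Module.finrank_self k

theorem finrank_quotient_RelOf_zero :
    Module.finrank k (↥(TP k V 0) ⧸ RelOf k V R 0) = 1 := by
  have h : RelOf k V R 0 = ⊥ := by
    rw [RelOf, iSup_eq_bot]
    exact fun i => i.elim0
  rw [h, (Submodule.quotEquivOfEqBot _ rfl).finrank_eq]
  exact Module.finrank_self k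

/-- **Poincaré series of a Koszul algebra.**  Let `A = T(V)/(R)` be a quadratic algebra on a
finite-dimensional vector space `V` (so that all `A_d` and `A^¡_d` are finite dimensional).
If `A` is Koszul then, in `ℤ⟦x⟧`,
`(Σ_{d≥0} (−1)^d dim A^¡_d xᵈ) · (Σ_{d≥0} dim A_d xᵈ) = 1`
(here `A_d = V^{⊗d}/Rel d`). -/
theorem statement5 [FiniteDimensional k V] (R : Submodule k ↥(TP k V 2))
    (hA : IsKoszul k V R) :
    (PowerSeries.mk fun d => ((-1 : ℤ)) ^ d * (Module.finrank k ↥(Dual k V R d) : ℤ)) *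
      (PowerSeries.mk fun d => (Module.finrank k (↥(TP k V d) ⧸ RelOf k V R d) : ℤ)) = 1 := by
  ext ρ
  rw [PowerSeries.coeff_mul, Finset.Nat.sum_antidiagonal_eq_sum_range_succ_mk,
    PowerSeries.coeff_one]
  simp only [PowerSeries.coeff_mk]
  split_ifs with hρ
  · subst hρ
    simp [finrank_Dual_zero, finrank_quotient_RelOf_zero]
  · rw [← IsKoszul.alternating_sum_eq_zero k V R hA (Nat.one_le_iff_ne_zero.mpr hρ)]
    refine Finset.sum_congr rfl fun d hd => ?_
    rw [mul_assoc, finrank_Dual_mul_finrank_quotient k V R (Finset.mem_range_succ_iff.mp hd)]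

end Quadratic
end

section
/- The Koszul complex of A in weight ρ is exact for every ρ ≥ 1 if and only if the left Koszul complex of A in weight ρ is exact for every ρ ≥ 1. -/
set_option linter.unusedSectionVars false

open TensorProduct

noncomputable section Quadratic

variable (k : Type) [Field k] [CharZero k]
variable (V : Type) [AddCommGroup V] [Module k V]

variable (R : Submodule k ↥(TP k V 2))

/-- The numerator `V^{⊗(ρ−d)} ⊗ A^¡_d` of the `d`-th term of the *left* Koszul complex of
weight `ρ` (whose `d`-th term is `A_{ρ−d} ⊗ A^¡_d = KtL ρ d / KrL ρ d`, realized as a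
subquotient of `V^{⊗ρ}`, the differentials being induced by the identity of `V^{⊗ρ}`). -/
def KtL (ρ d : ℕ) : Submodule k ↥(TP k V ρ) :=
  if h : d ≤ ρ then
    castTP k V (by omega) (concatSub k V (⊤ : Submodule k ↥(TP k V (ρ - d))) (Dual k V R d))
  else ⊥

/-- The denominator `(RelOf (ρ−d)) ⊗ A^¡_d` of the `d`-th term of the left Koszul complex of
weight `ρ`, so that this term is `A_{ρ−d} ⊗ A^¡_d = KtL ρ d / KrL ρ d`. -/
def KrL (ρ d : ℕ) : Submodule k ↥(TP k V ρ) :=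
  if h : d ≤ ρ then
    castTP k V (by omega) (concatSub k V (RelOf k V R (ρ - d)) (Dual k V R d))
  else ⊥

/-- The left Koszul complex
`0 → A^¡_ρ → A_1 ⊗ A^¡_{ρ−1} → ⋯ → A_{ρ−1} ⊗ A^¡_1 → A_ρ → 0`
of weight `ρ` is exact for every `ρ ≥ 1` (exactness at the `d`-th term, realized as the
subquotient `KtL ρ d / KrL ρ d` of `V^{⊗ρ}`, reads as below). -/
def IsKoszulLeft : Prop :=
  ∀ ρ ≥ 1, ∀ d ≤ ρ,
    KtL k V R ρ d ⊓ (if d = 0 then ⊤ else KrL k V R ρ (d - 1)) =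
      KrL k V R ρ d ⊔ KtL k V R ρ (d + 1)

section Lattice

variable {L : Type*} [Lattice L] [IsModularLattice L]

/-- The triple `a, b, c` satisfies the distributive law `a ⊓ (b ⊔ c) = a ⊓ b ⊔ a ⊓ c`. -/
def DistribTriple (a b c : L) : Prop := a ⊓ (b ⊔ c) ≤ a ⊓ b ⊔ a ⊓ c

theorem DistribTriple.inf_sup_eq {a b c : L} (h : DistribTriple a b c) :
    a ⊓ (b ⊔ c) = a ⊓ b ⊔ a ⊓ c :=
  le_antisymm h le_inf_sup

theorem inf_sup_eq_iff_distribTriple {a b c : L} :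
    a ⊓ (b ⊔ c) = a ⊓ c ⊔ a ⊓ b ↔ DistribTriple a b c := by
  rw [sup_comm (a ⊓ c)]
  exact ⟨le_of_eq, DistribTriple.inf_sup_eq⟩

theorem DistribTriple.swap_left {a b c : L} (h : DistribTriple a b c) : DistribTriple b a c := by
  have h1 : (c ⊔ a) ⊓ (b ⊔ c) = c ⊔ a ⊓ b := by
    rw [sup_inf_assoc_of_le a (le_sup_right : c ≤ b ⊔ c), h.inf_sup_eq]
    refine le_antisymm (sup_le le_sup_left (sup_le le_sup_right ?_)) ?_
    · exact inf_le_right.trans le_sup_left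
    · exact sup_le le_sup_left (le_sup_left.trans le_sup_right)
  calc b ⊓ (a ⊔ c) ≤ (a ⊓ b ⊔ c) ⊓ b := by
        refine le_inf ?_ inf_le_left
        rw [sup_comm (a ⊓ b), ← h1]
        exact le_inf (inf_le_right.trans (sup_comm a c).le) (inf_le_left.trans le_sup_left)
    _ = a ⊓ b ⊔ c ⊓ b := sup_inf_assoc_of_le c inf_le_right
    _ = b ⊓ a ⊔ b ⊓ c := by rw [inf_comm a b, inf_comm c b]

theorem distribTriple_inf_iff {p a b s : L} (ha : DistribTriple p a s) (hb : DistribTriple p b s) :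
    DistribTriple (p ⊓ a) b s ↔ DistribTriple (p ⊓ b) a s := by
  have key : ∀ {a b : L}, DistribTriple p b s →
      (DistribTriple (p ⊓ a) b s ↔ DistribTriple (p ⊓ a) (p ⊓ b) (p ⊓ s)) := by
    intro a b hb
    have h1 : p ⊓ a ⊓ (b ⊔ s) = p ⊓ a ⊓ (p ⊓ b ⊔ p ⊓ s) := by
      rw [← hb.inf_sup_eq, inf_inf_inf_comm, inf_idem, inf_assoc]
    have h2 : ∀ c, p ⊓ a ⊓ (p ⊓ c) = p ⊓ a ⊓ c := fun c => by
      rw [inf_inf_inf_comm, inf_idem, inf_assoc]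
    rw [DistribTriple, DistribTriple, h1, h2, h2]
  rw [key hb, key ha]
  exact ⟨DistribTriple.swap_left, DistribTriple.swap_left⟩

theorem distribTriple_sup_iff {p a b s : L} (ha : DistribTriple p a s)
    (hb : DistribTriple p b s) : DistribTriple p a (s ⊔ b) ↔ DistribTriple p b (s ⊔ a) := by
  have key : ∀ {a b : L}, DistribTriple p a s → DistribTriple p b s →
      DistribTriple p a (s ⊔ b) → DistribTriple p b (s ⊔ a) := by
    intro a b ha hb h
    calc p ⊓ (b ⊔ (s ⊔ a)) = p ⊓ (a ⊔ (s ⊔ b)) := by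
          congr 1; rw [sup_comm s a, sup_comm s b, sup_left_comm]
      _ ≤ p ⊓ a ⊔ p ⊓ (s ⊔ b) := h
      _ ≤ p ⊓ b ⊔ p ⊓ (s ⊔ a) := by
          refine sup_le ((inf_le_inf_left p le_sup_right).trans le_sup_right) ?_
          rw [sup_comm s b, hb.inf_sup_eq]
          exact sup_le_sup_left (inf_le_inf_left p le_sup_left) _
  exact ⟨key ha hb, key hb ha⟩

variable [OrderBot L] [OrderTop L] {ι : Type*} [DecidableEq ι] {t : L} {x : ι → L} {G : Finset ι}

theorem Finset.sdiff_insert_eq_insert {I : Finset ι} {a b : ι} (hb : b ∈ G) (hbI : b ∉ I)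
    (hab : a ≠ b) : G \ insert a I = insert b (G \ insert a (insert b I)) := by
  ext i
  simp only [Finset.mem_sdiff, Finset.mem_insert]
  rcases eq_or_ne i b with rfl | hi
  · simp [hb, hbI, hab.symm]
  · simp [hi]

theorem Finset.insert_union_sdiff_ssubset {I : Finset ι} {a b : ι} (hI : I ⊆ G) (ha : a ∈ G)
    (hb : b ∈ G) (hbI : b ∉ I) (hab : a ≠ b) :
    insert a (I ∪ G \ insert a (insert b I)) ⊂ G :=
  (Finset.ssubset_iff_of_subset (Finset.insert_subset ha (Finset.union_subset hI
    Finset.sdiff_subset))).2 ⟨b, hb, by simp [hbI, hab.symm]⟩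

/-- The distributive laws for the meet (inside `t`) of the `x i` with `i ∈ I`, the element `x c`,
and the join of the `x j` with `j ∈ J`. -/
def DistribAt (t : L) (x : ι → L) (I : Finset ι) (c : ι) (J : Finset ι) : Prop :=
  DistribTriple (t ⊓ I.inf x) (x c) (J.sup x)

/-- Partitions `I ⊔ {c} ⊔ J` of `G` with `I` of a given size are related by
exchanges, so the distributive law for one of them gives it for all. -/
theorem distribAt_of_card_eq
    (hproper : ∀ I c J, c ∉ I → c ∉ J → Disjoint I J → insert c (I ∪ J) ⊂ G → DistribAt t x I c J)
    {I : Finset ι} {c : ι} (hI : I ⊆ G) (hc : c ∈ G) (hcI : c ∉ I) {I' : Finset ι} {c' : ι}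
    (hI' : I' ⊆ G) (hc' : c' ∈ G) (hcI' : c' ∉ I') (hcard : I.card = I'.card)
    (h : DistribAt t x I c (G \ insert c I)) : DistribAt t x I' c' (G \ insert c' I') := by
  have move_sup : ∀ {I : Finset ι} {a b : ι}, I ⊆ G → a ∈ G → b ∈ G → a ∉ I → b ∉ I →
      DistribAt t x I a (G \ insert a I) → DistribAt t x I b (G \ insert b I) := by
    intro I a b hI ha hb haI hbI h
    rcases eq_or_ne a b with rfl | hab
    · exact h
    set J := G \ insert a (insert b I) with hJ
    have e1 : G \ insert a I = insert b J := Finset.sdiff_insert_eq_insert hb hbI hab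
    have e2 : G \ insert b I = insert a J := by
      rw [hJ, Finset.insert_comm]; exact Finset.sdiff_insert_eq_insert ha haI hab.symm
    have hd : Disjoint I J := Finset.disjoint_left.2 fun i hi hiJ => by simp [hJ, hi] at hiJ
    have h1 : DistribAt t x I a J := hproper I a J haI (by simp [hJ]) hd
      (Finset.insert_union_sdiff_ssubset hI ha hb hbI hab)
    have h2 : DistribAt t x I b J := hproper I b J hbI (by simp [hJ]) hd
      (by rw [hJ, Finset.insert_comm]
          exact Finset.insert_union_sdiff_ssubset hI hb ha haI hab.symm)
    rw [DistribAt, e1, Finset.sup_insert, sup_comm] at h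
    rw [DistribAt, e2, Finset.sup_insert, sup_comm (x a)]
    exact (distribTriple_sup_iff h1 h2).1 h
  have move_inf : ∀ {K : Finset ι} {a b : ι}, K ⊆ G → a ∈ G → b ∈ G → a ∉ K → b ∉ K → a ≠ b →
      DistribAt t x (insert a K) b (G \ insert b (insert a K)) →
      DistribAt t x (insert b K) a (G \ insert a (insert b K)) := by
    intro K a b hK ha hb haK hbK hab h
    rw [Finset.insert_comm a b]
    set J := G \ insert b (insert a K) with hJ
    have hd : Disjoint K J := Finset.disjoint_left.2 fun i hi hiJ => by simp [hJ, hi] at hiJ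
    have h1 : DistribAt t x K a J := hproper K a J haK (by simp [hJ]) hd
      (by rw [hJ, Finset.insert_comm]
          exact Finset.insert_union_sdiff_ssubset hK ha hb hbK hab)
    have h2 : DistribAt t x K b J := hproper K b J hbK (by simp [hJ]) hd
      (Finset.insert_union_sdiff_ssubset hK hb ha haK hab.symm)
    rw [DistribAt, Finset.inf_insert, inf_comm (x a), ← inf_assoc] at h
    rw [DistribAt, Finset.inf_insert, inf_comm (x b), ← inf_assoc]
    exact (distribTriple_inf_iff h1 h2).1 h
  induction hn : (I \ I').card generalizing I c with
  | zero =>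
    have hsub : I ⊆ I' := by
      rwa [Finset.card_eq_zero, Finset.sdiff_eq_empty_iff_subset] at hn
    obtain rfl : I = I' := Finset.eq_of_subset_of_card_le hsub hcard.ge
    exact move_sup hI hc hc' hcI hcI' h
  | succ n ih =>
    obtain ⟨a, ha⟩ : (I \ I').Nonempty := Finset.card_pos.1 (by omega)
    obtain ⟨b, hb⟩ : (I' \ I).Nonempty :=
      Finset.card_pos.1 (by rw [← Finset.card_sdiff_comm hcard]; omega)
    rw [Finset.mem_sdiff] at ha hb
    have hab : a ≠ b := fun e => hb.2 (e ▸ ha.1)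
    have haK : a ∉ I.erase a := Finset.notMem_erase a I
    have hbK : b ∉ I.erase a := fun h => hb.2 (Finset.mem_of_mem_erase h)
    have hK : I.erase a ⊆ G := (Finset.erase_subset a I).trans hI
    have h1 := move_sup hI hc (hI' hb.1) hcI hb.2 h
    rw [← Finset.insert_erase ha.1] at h1
    have h2 := move_inf hK (hI ha.1) (hI' hb.1) haK hbK hab h1
    refine ih (Finset.insert_subset (hI' hb.1) hK) (hI ha.1) (by simp [hab]) ?_ h2 ?_
    · rw [Finset.card_insert_of_notMem hbK, Finset.card_erase_add_one ha.1, hcard]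
    · have : insert b (I.erase a) \ I' = (I \ I').erase a := by
        ext i; simp only [Finset.mem_sdiff, Finset.mem_insert, Finset.mem_erase]; grind
      rw [this, Finset.card_erase_of_mem (Finset.mem_sdiff.2 ha), hn, Nat.add_sub_cancel]

end Lattice

section LinearDisjoint

open Submodule

variable {F S : Type*} [Field F] [Ring S] [Algebra F S] {M N : Submodule F S}

theorem ker_tensorMap_eq {A B A' B' : Type*} [AddCommGroup A] [AddCommGroup B] [AddCommGroup A']
    [AddCommGroup B'] [Module F A] [Module F B] [Module F A'] [Module F B']
    (f : A →ₗ[F] A') (g : B →ₗ[F] B') :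
    LinearMap.ker (TensorProduct.map f g) =
      LinearMap.range (LinearMap.lTensor A (LinearMap.ker g).subtype) ⊔
        LinearMap.range (LinearMap.rTensor B (LinearMap.ker f).subtype) := by
  have hinj : Function.Injective
      (TensorProduct.map (LinearMap.range f).subtype (LinearMap.range g).subtype) :=
    TensorProduct.map_injective_of_flat_flat _ _ (injective_subtype _) (injective_subtype _)
  have hcomp : TensorProduct.map f g =
      (TensorProduct.map (LinearMap.range f).subtype (LinearMap.range g).subtype) ∘ₗ
        TensorProduct.map f.rangeRestrict g.rangeRestrict := by
    rw [← TensorProduct.map_comp]; rfl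
  have hf : Function.Exact (LinearMap.ker f).subtype f.rangeRestrict := by
    rw [LinearMap.exact_iff]; simp
  have hg : Function.Exact (LinearMap.ker g).subtype g.rangeRestrict := by
    rw [LinearMap.exact_iff]; simp
  rw [hcomp, LinearMap.ker_comp, LinearMap.ker_eq_bot.2 hinj, comap_bot]
  exact TensorProduct.map_ker hf f.surjective_rangeRestrict hg g.surjective_rangeRestrict

theorem Submodule.LinearDisjoint.mul_inf_le (H : M.LinearDisjoint N) {A C B D : Submodule F S}
    (hA : A ≤ M) (hC : C ≤ M) (hB : B ≤ N) (hD : D ≤ N) :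
    (A * B) ⊓ (C * N ⊔ M * D) ≤ (A ⊓ C) * B ⊔ A * (B ⊓ D) := by
  set f := (C.submoduleOf M).mkQ
  set g := (D.submoduleOf N).mkQ
  have h1 : C * N ⊔ M * D ≤ Submodule.map (mulMap M N) (LinearMap.ker (TensorProduct.map f g)) := by
    refine sup_le (mul_le.2 fun c hc n hn => ?_) (mul_le.2 fun m hm d hd => ?_)
    · have hf : f ⟨c, hC hc⟩ = 0 := (Quotient.mk_eq_zero _).2 hc
      exact ⟨⟨c, hC hc⟩ ⊗ₜ ⟨n, hn⟩, by simp [hf], by simp⟩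
    · have hg : g ⟨d, hD hd⟩ = 0 := (Quotient.mk_eq_zero _).2 hd
      exact ⟨⟨m, hm⟩ ⊗ₜ ⟨d, hD hd⟩, by simp [hg], by simp⟩
  rintro x ⟨hx, hx'⟩
  rw [SetLike.mem_coe, ← mulMap_range] at hx
  obtain ⟨y, rfl⟩ := hx
  obtain ⟨z, hz, hzy⟩ := h1 hx'
  have hyz : TensorProduct.map (inclusion hA) (inclusion hB) y = z := by
    apply H.injective
    rw [hzy, ← LinearMap.comp_apply]
    congr 1
    ext; rfl
  have hy : y ∈ LinearMap.ker (TensorProduct.map (f ∘ₗ inclusion hA) (g ∘ₗ inclusion hB)) := by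
    rw [LinearMap.mem_ker, TensorProduct.map_comp, LinearMap.comp_apply, hyz]
    exact hz
  rw [ker_tensorMap_eq] at hy
  refine (?_ : _ ≤ Submodule.comap (mulMap A B) ((A ⊓ C) * B ⊔ A * (B ⊓ D))) hy
  refine sup_le ?_ ?_
  · rintro _ ⟨w, rfl⟩
    induction w with
    | zero => simp
    | add u v hu hv => rw [map_add]; exact add_mem hu hv
    | tmul a b =>
      have hb : (b : B).1 ∈ D := (Quotient.mk_eq_zero (D.submoduleOf N) (x := inclusion hB b)).1 b.2
      exact mem_sup_right (mul_mem_mul a.2 ⟨b.1.2, hb⟩)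
  · rintro _ ⟨w, rfl⟩
    induction w with
    | zero => simp
    | add u v hu hv => rw [map_add]; exact add_mem hu hv
    | tmul a b =>
      have ha : (a : A).1 ∈ C := (Quotient.mk_eq_zero (C.submoduleOf M) (x := inclusion hA a)).1 a.2
      exact mem_sup_left (mul_mem_mul ⟨a.1.2, ha⟩ b.2)

theorem Submodule.LinearDisjoint.inf_mul_eq (H : M.LinearDisjoint N) {A C : Submodule F S}
    (hA : A ≤ M) (hC : C ≤ M) : (A ⊓ C) * N = A * N ⊓ C * N := by
  refine le_antisymm (le_inf (mul_le_mul_left inf_le_left _) (mul_le_mul_left inf_le_right _)) ?_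
  simpa using H.mul_inf_le hA hC le_rfl bot_le

theorem Submodule.LinearDisjoint.mul_inf_eq (H : M.LinearDisjoint N) {B D : Submodule F S}
    (hB : B ≤ N) (hD : D ≤ N) : M * (B ⊓ D) = M * B ⊓ M * D := by
  refine le_antisymm (le_inf (mul_le_mul_right inf_le_left _) (mul_le_mul_right inf_le_right _)) ?_
  simpa using H.mul_inf_le le_rfl bot_le hB hD

theorem Submodule.LinearDisjoint.mul_eq_inf (H : M.LinearDisjoint N) {A B : Submodule F S}
    (hA : A ≤ M) (hB : B ≤ N) : A * B = A * N ⊓ M * B := by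
  refine le_antisymm (le_inf (mul_le_mul_right hB _) (mul_le_mul_left hA _)) ?_
  simpa [inf_eq_right.2 hB] using H.mul_inf_le hA bot_le le_rfl hB

theorem Submodule.LinearDisjoint.distribTriple_left (H : M.LinearDisjoint N)
    {P X S₁ Q S₂ : Submodule F S} (hP : P ≤ M) (hX : X ≤ M) (hS₁ : S₁ ≤ M) (hQ : Q ≤ N)
    (hS₂ : S₂ ≤ N) (h : DistribTriple P X S₁) :
    DistribTriple (P * Q) (X * N) (S₁ * N ⊔ M * S₂) := by
  have hXN : (P ⊓ X) * Q ≤ P * Q ⊓ X * N :=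
    le_inf (mul_le_mul_left inf_le_left _) (mul_le_mul' inf_le_right hQ)
  have hSN : (P ⊓ S₁) * Q ≤ P * Q ⊓ (S₁ * N ⊔ M * S₂) :=
    le_inf (mul_le_mul_left inf_le_left _) ((mul_le_mul' inf_le_right hQ).trans le_sup_left)
  have hSM : P * (Q ⊓ S₂) ≤ P * Q ⊓ (S₁ * N ⊔ M * S₂) :=
    le_inf (mul_le_mul_right inf_le_left _) ((mul_le_mul' hP inf_le_right).trans le_sup_right)
  calc P * Q ⊓ (X * N ⊔ (S₁ * N ⊔ M * S₂)) = P * Q ⊓ ((X ⊔ S₁) * N ⊔ M * S₂) := by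
        rw [Submodule.sup_mul, sup_assoc]
    _ ≤ (P ⊓ (X ⊔ S₁)) * Q ⊔ P * (Q ⊓ S₂) := H.mul_inf_le hP (sup_le hX hS₁) hQ hS₂
    _ ≤ (P ⊓ X ⊔ P ⊓ S₁) * Q ⊔ P * (Q ⊓ S₂) := sup_le_sup_right (mul_le_mul_left h _) _
    _ ≤ _ := by
        rw [Submodule.sup_mul]
        exact sup_le (sup_le (hXN.trans le_sup_left) (hSN.trans le_sup_right))
          (hSM.trans le_sup_right)

theorem Submodule.LinearDisjoint.distribTriple_right (H : M.LinearDisjoint N)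
    {P X S₁ Q S₂ : Submodule F S} (hP : P ≤ M) (hX : X ≤ N) (hS₁ : S₁ ≤ M) (hQ : Q ≤ N)
    (hS₂ : S₂ ≤ N) (h : DistribTriple Q X S₂) :
    DistribTriple (P * Q) (M * X) (S₁ * N ⊔ M * S₂) := by
  have hMX : P * (Q ⊓ X) ≤ P * Q ⊓ M * X :=
    le_inf (mul_le_mul_right inf_le_left _) (mul_le_mul' hP inf_le_right)
  have hSN : (P ⊓ S₁) * Q ≤ P * Q ⊓ (S₁ * N ⊔ M * S₂) :=
    le_inf (mul_le_mul_left inf_le_left _) ((mul_le_mul' inf_le_right hQ).trans le_sup_left)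
  have hSM : P * (Q ⊓ S₂) ≤ P * Q ⊓ (S₁ * N ⊔ M * S₂) :=
    le_inf (mul_le_mul_right inf_le_left _) ((mul_le_mul' hP inf_le_right).trans le_sup_right)
  calc P * Q ⊓ (M * X ⊔ (S₁ * N ⊔ M * S₂)) = P * Q ⊓ (S₁ * N ⊔ M * (X ⊔ S₂)) := by
        rw [Submodule.mul_sup, sup_left_comm]
    _ ≤ (P ⊓ S₁) * Q ⊔ P * (Q ⊓ (X ⊔ S₂)) := H.mul_inf_le hP hS₁ hQ (sup_le hX hS₂)
    _ ≤ (P ⊓ S₁) * Q ⊔ P * (Q ⊓ X ⊔ Q ⊓ S₂) := sup_le_sup_left (mul_le_mul_right h _) _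
    _ ≤ _ := by
        rw [Submodule.mul_sup]
        exact sup_le (hSN.trans le_sup_right) (sup_le (hMX.trans le_sup_left)
          (hSM.trans le_sup_right))

end LinearDisjoint

section QuadraticRelations

variable {F S : Type*} [Field F] [Ring S] [Algebra F S] {W Q : Submodule F S}

/-- The span `W ^ i * Q * W ^ (n - 2 - i)` of the products of length `n` with the quadratic
relations `Q` inserted after `i` factors. -/
def relPow (W Q : Submodule F S) (n i : ℕ) : Submodule F S := W ^ i * Q * W ^ (n - 2 - i)

theorem relPow_mul_pow {p i : ℕ} (h : i + 2 ≤ p) (q : ℕ) :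
    relPow W Q p i * W ^ q = relPow W Q (p + q) i := by
  rw [relPow, relPow, mul_assoc, ← pow_add]
  congr 2
  omega

theorem pow_mul_relPow (p q i : ℕ) :
    W ^ p * relPow W Q q i = relPow W Q (p + q) (p + i) := by
  rw [relPow, relPow, ← mul_assoc, ← mul_assoc, ← pow_add]
  congr 2
  omega

theorem relPow_le (hQ : Q ≤ W ^ 2) {n i : ℕ} (h : i + 2 ≤ n) : relPow W Q n i ≤ W ^ n := by
  obtain ⟨m, rfl⟩ := Nat.exists_eq_add_of_le h
  rw [relPow, pow_add, pow_add, show i + 2 + m - 2 - i = m by omega]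
  exact mul_le_mul_left (mul_le_mul_right hQ _) _

/-- The part of `W ^ n` lying in all the `relPow W Q n i` with `i ∈ I`. -/
def relInf (W Q : Submodule F S) (n : ℕ) (I : Finset ℕ) : Submodule F S :=
  W ^ n ⊓ I.inf (relPow W Q n)

/-- The sum of the `relPow W Q n i` with `i ∈ I`. -/
def relSup (W Q : Submodule F S) (n : ℕ) (I : Finset ℕ) : Submodule F S := I.sup (relPow W Q n)

theorem relInf_le {n : ℕ} {I : Finset ℕ} : relInf W Q n I ≤ W ^ n := inf_le_left

theorem relInf_empty (n : ℕ) : relInf W Q n ∅ = W ^ n := by simp [relInf]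

theorem relInf_insert (n i : ℕ) (I : Finset ℕ) :
    relInf W Q n (insert i I) = relInf W Q n I ⊓ relPow W Q n i := by
  rw [relInf, relInf, Finset.inf_insert, inf_comm (relPow W Q n i), inf_assoc]

theorem relInf_union (n : ℕ) (I J : Finset ℕ) :
    relInf W Q n (I ∪ J) = relInf W Q n I ⊓ relInf W Q n J := by
  rw [relInf, relInf, relInf, Finset.inf_union, inf_inf_distrib_left]

theorem relInf_anti {n : ℕ} {I J : Finset ℕ} (h : I ⊆ J) : relInf W Q n J ≤ relInf W Q n I :=
  inf_le_inf_left _ (Finset.inf_mono h)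

theorem relSup_le (hQ : Q ≤ W ^ 2) {n : ℕ} {I : Finset ℕ} (hI : ∀ i ∈ I, i + 2 ≤ n) :
    relSup W Q n I ≤ W ^ n :=
  Finset.sup_le fun i hi => relPow_le hQ (hI i hi)

theorem relSup_mul_pow {p : ℕ} {I : Finset ℕ} (hI : ∀ i ∈ I, i + 2 ≤ p) (q : ℕ) :
    relSup W Q p I * W ^ q = relSup W Q (p + q) I := by
  rw [relSup, relSup, Finset.sup_eq_iSup, Finset.sup_eq_iSup]
  simp_rw [Submodule.iSup_mul]
  exact iSup_congr fun i => iSup_congr fun hi => relPow_mul_pow (hI i hi) q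

theorem pow_mul_relSup (p q : ℕ) (I : Finset ℕ) :
    W ^ p * relSup W Q q I = relSup W Q (p + q) (I.image (p + ·)) := by
  rw [relSup, relSup, Finset.sup_image, Finset.sup_eq_iSup, Finset.sup_eq_iSup]
  simp_rw [Submodule.mul_iSup]
  exact iSup_congr fun i => iSup_congr fun _ => pow_mul_relPow p q i

theorem relInf_mul_pow (hW : ∀ p q, (W ^ p).LinearDisjoint (W ^ q)) (hQ : Q ≤ W ^ 2) {p : ℕ}
    {I : Finset ℕ} (hI : ∀ i ∈ I, i + 2 ≤ p) (q : ℕ) :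
    relInf W Q p I * W ^ q = relInf W Q (p + q) I := by
  induction I using Finset.induction_on with
  | empty => rw [relInf_empty, relInf_empty, pow_add]
  | insert i I hi ih =>
    have h := hI i (Finset.mem_insert_self i I)
    rw [relInf_insert, relInf_insert, (hW p q).inf_mul_eq relInf_le (relPow_le hQ h),
      relPow_mul_pow h, ih fun j hj => hI j (Finset.mem_insert_of_mem hj)]

theorem pow_mul_relInf (hW : ∀ p q, (W ^ p).LinearDisjoint (W ^ q)) (hQ : Q ≤ W ^ 2) (p : ℕ)
    {q : ℕ} {I : Finset ℕ} (hI : ∀ i ∈ I, i + 2 ≤ q) :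
    W ^ p * relInf W Q q I = relInf W Q (p + q) (I.image (p + ·)) := by
  induction I using Finset.induction_on with
  | empty => rw [Finset.image_empty, relInf_empty, relInf_empty, pow_add]
  | insert i I hi ih =>
    have h := hI i (Finset.mem_insert_self i I)
    rw [Finset.image_insert, relInf_insert, relInf_insert,
      (hW p q).mul_inf_eq relInf_le (relPow_le hQ h), pow_mul_relPow,
      ih fun j hj => hI j (Finset.mem_insert_of_mem hj)]

/-- The distributive law for `relInf W Q n I`, `relPow W Q n c` and `relSup W Q n J`. -/
def RelDistrib (W Q : Submodule F S) (n : ℕ) (I : Finset ℕ) (c : ℕ) (J : Finset ℕ) : Prop :=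
  DistribTriple (relInf W Q n I) (relPow W Q n c) (relSup W Q n J)

theorem Finset.exists_eq_union_image {I : Finset ℕ} {j : ℕ} (hj : j ∉ I) :
    ∃ I₁ I₂ : Finset ℕ, (∀ i ∈ I₁, i < j) ∧ I = I₁ ∪ I₂.image (j + 1 + ·) := by
  refine ⟨I.filter (· < j), (I.filter (j < ·)).image (· - (j + 1)), by simp, ?_⟩
  ext i
  simp only [Finset.mem_union, Finset.mem_filter, Finset.mem_image, exists_exists_and_eq_and]
  constructor
  · intro hi
    rcases lt_trichotomy i j with h | rfl | h
    · exact .inl ⟨hi, h⟩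
    · exact absurd hi hj
    · exact .inr ⟨i, ⟨hi, h⟩, by omega⟩
  · rintro (h | ⟨a, ⟨ha, hja⟩, h⟩)
    · exact h.1
    · rwa [← h, show j + 1 + (a - (j + 1)) = a by omega]

theorem relDistrib_of_initial (hW : ∀ p q, (W ^ p).LinearDisjoint (W ^ q)) (hQ : Q ≤ W ^ 2)
    (hinit : ∀ n p, p + 2 ≤ n → ∃ I c, I ⊆ Finset.range (n - 1) ∧ c ∈ Finset.range (n - 1) ∧
      c ∉ I ∧ I.card = p ∧ RelDistrib W Q n I c (Finset.range (n - 1) \ insert c I))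
    (n : ℕ) (I : Finset ℕ) (c : ℕ) (J : Finset ℕ) (hcI : c ∉ I) (hcJ : c ∉ J)
    (hIJ : Disjoint I J) (hG : insert c (I ∪ J) ⊆ Finset.range (n - 1)) :
    RelDistrib W Q n I c J := by
  induction n using Nat.strong_induction_on generalizing I c J with
  | _ n ih =>
  have hproper : ∀ I c J, c ∉ I → c ∉ J → Disjoint I J →
      insert c (I ∪ J) ⊂ Finset.range (n - 1) → RelDistrib W Q n I c J := by
    intro I c J hcI hcJ hIJ hG
    obtain ⟨j, hj, hjn⟩ := Finset.exists_of_ssubset hG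
    have hsub := hG.subset
    simp only [Finset.insert_subset_iff, Finset.union_subset_iff] at hsub
    obtain ⟨hc, hI, hJ⟩ := hsub
    simp only [Finset.mem_insert, Finset.mem_union, not_or] at hjn
    obtain ⟨hjc, hjI, hjJ⟩ := hjn
    rw [Finset.mem_range] at hj hc
    obtain ⟨q, rfl⟩ : ∃ q, n = j + 1 + q := ⟨n - (j + 1), by omega⟩
    obtain ⟨I₁, I₂, hI₁, rfl⟩ := Finset.exists_eq_union_image hjI
    obtain ⟨J₁, J₂, hJ₁, rfl⟩ := Finset.exists_eq_union_image hjJ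
    have hI₂ : ∀ i ∈ I₂, i + 2 ≤ q := fun i hi => by
      have := Finset.mem_range.1 (hI (Finset.mem_union_right _ (Finset.mem_image_of_mem _ hi)))
      omega
    have hJ₂ : ∀ i ∈ J₂, i + 2 ≤ q := fun i hi => by
      have := Finset.mem_range.1 (hJ (Finset.mem_union_right _ (Finset.mem_image_of_mem _ hi)))
      omega
    have hI₁' : ∀ i ∈ I₁, i + 2 ≤ j + 1 := fun i hi => by have := hI₁ i hi; omega
    have hJ₁' : ∀ i ∈ J₁, i + 2 ≤ j + 1 := fun i hi => by have := hJ₁ i hi; omega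
    have hinf : relInf W Q (j + 1 + q) (I₁ ∪ I₂.image (j + 1 + ·)) =
        relInf W Q (j + 1) I₁ * relInf W Q q I₂ := by
      rw [relInf_union, (hW _ _).mul_eq_inf relInf_le relInf_le, relInf_mul_pow hW hQ hI₁',
        pow_mul_relInf hW hQ _ hI₂]
    have hsup : relSup W Q (j + 1 + q) (J₁ ∪ J₂.image (j + 1 + ·)) =
        relSup W Q (j + 1) J₁ * W ^ q ⊔ W ^ (j + 1) * relSup W Q q J₂ := by
      rw [relSup_mul_pow hJ₁', pow_mul_relSup, relSup, Finset.sup_union]; rfl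
    rw [RelDistrib, hinf, hsup]
    rcases lt_or_gt_of_ne (Ne.symm hjc) with hlt | hgt
    · rw [← relPow_mul_pow (show c + 2 ≤ j + 1 by omega)]
      refine (hW _ _).distribTriple_left relInf_le (relPow_le hQ (by omega)) (relSup_le hQ hJ₁')
        relInf_le (relSup_le hQ hJ₂) (ih (j + 1) (by omega) I₁ c J₁
          (fun h => hcI (Finset.mem_union_left _ h)) (fun h => hcJ (Finset.mem_union_left _ h))
          (hIJ.mono Finset.subset_union_left Finset.subset_union_left) ?_)
      intro i hi
      simp only [Finset.mem_insert, Finset.mem_union] at hi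
      rw [Finset.mem_range]
      rcases hi with rfl | hi | hi
      · omega
      · exact hI₁ i hi
      · exact hJ₁ i hi
    · obtain ⟨c, rfl⟩ : ∃ d, c = j + 1 + d := ⟨c - (j + 1), by omega⟩
      rw [← pow_mul_relPow]
      refine (hW _ _).distribTriple_right relInf_le (relPow_le hQ (by omega))
        (relSup_le hQ hJ₁') relInf_le (relSup_le hQ hJ₂) (ih q (by omega) I₂ c J₂
          (fun h => hcI (Finset.mem_union_right _ (Finset.mem_image_of_mem _ h)))
          (fun h => hcJ (Finset.mem_union_right _ (Finset.mem_image_of_mem _ h)))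
          ((Finset.disjoint_image (add_right_injective (j + 1))).1
            (hIJ.mono Finset.subset_union_right Finset.subset_union_right)) ?_)
      intro i hi
      simp only [Finset.mem_insert, Finset.mem_union] at hi
      rw [Finset.mem_range]
      rcases hi with rfl | hi | hi
      · omega
      · have := hI₂ i hi; omega
      · have := hJ₂ i hi; omega
  rcases hG.eq_or_ssubset with heq | hss
  · have hJ : J = Finset.range (n - 1) \ insert c I := by
      rw [← heq, ← Finset.insert_union, Finset.union_sdiff_cancel_left]
      exact Finset.disjoint_insert_left.2 ⟨hcJ, hIJ⟩
    have hc : c ∈ Finset.range (n - 1) := hG (Finset.mem_insert_self _ _)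
    have hI : I ⊆ Finset.range (n - 1) :=
      (Finset.subset_union_left.trans (Finset.subset_insert _ _)).trans hG
    have hcard : I.card + 2 ≤ n := by
      have := Finset.card_le_card (Finset.insert_subset hc hI)
      rw [Finset.card_insert_of_notMem hcI, Finset.card_range] at this
      omega
    obtain ⟨I₀, c₀, hI₀, hc₀, hcI₀, hI₀I, h₀⟩ := hinit n I.card hcard
    rw [hJ]
    exact distribAt_of_card_eq hproper hI₀ hc₀ hcI₀ hI hc hcI hI₀I h₀
  · exact hproper I c J hcI hcJ hIJ hss

/-- The distributive laws expressing exactness of the Koszul complexes and those expressing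
exactness of the left Koszul complexes are equivalent. -/
theorem relDistrib_range_iff (hW : ∀ p q, (W ^ p).LinearDisjoint (W ^ q)) (hQ : Q ≤ W ^ 2) :
    (∀ n c, c + 2 ≤ n → RelDistrib W Q n (Finset.range c) c (Finset.Ico (c + 1) (n - 1))) ↔
      ∀ n c, c + 2 ≤ n → RelDistrib W Q n (Finset.Ico (c + 1) (n - 1)) c (Finset.range c) := by
  constructor
  · intro h n c hc
    refine relDistrib_of_initial hW hQ (fun n p hp => ⟨Finset.range p, p, ?_, ?_, by simp,
      by simp, ?_⟩) n _ c _ (by simp) (by simp) ?_ ?_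
    · exact Finset.range_subset_range.2 (by omega)
    · exact Finset.mem_range.2 (by omega)
    · convert h n p hp using 1
      ext i; simp only [Finset.mem_sdiff, Finset.mem_insert, Finset.mem_range, Finset.mem_Ico]
      omega
    · exact Finset.disjoint_left.2 fun i => by simp only [Finset.mem_range, Finset.mem_Ico]; omega
    · intro i
      simp only [Finset.mem_insert, Finset.mem_union, Finset.mem_range, Finset.mem_Ico]
      omega
  · intro h n c hc
    refine relDistrib_of_initial hW hQ (fun n p hp => ⟨Finset.Ico (n - 1 - p) (n - 1),
      n - 2 - p, ?_, ?_, by simp; omega, by simp; omega, ?_⟩) n _ c _ (by simp) (by simp) ?_ ?_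
    · intro i; simp
    · exact Finset.mem_range.2 (by omega)
    · convert h n (n - 2 - p) (by omega) using 1
      · congr 1; omega
      · ext i; simp only [Finset.mem_sdiff, Finset.mem_insert, Finset.mem_range, Finset.mem_Ico]
        omega
    · exact Finset.disjoint_left.2 fun i => by simp only [Finset.mem_range, Finset.mem_Ico]; omega
    · intro i
      simp only [Finset.mem_insert, Finset.mem_union, Finset.mem_range, Finset.mem_Ico]
      omega

end QuadraticRelations

section TensorAlgebra

variable {F M : Type*} [Field F] [AddCommGroup M] [Module F M]

theorem TensorPower.toTensorAlgebra_injective (n : ℕ) :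
    Function.Injective (TensorPower.toTensorAlgebra (R := F) (M := M) (n := n)) := by
  intro x y h
  have key : ∀ z : ⨂[F]^n M, TensorAlgebra.toDirectSum (TensorPower.toTensorAlgebra z) =
      DirectSum.of (fun n => ⨂[F]^n M) n z := fun z => by
    rw [← TensorAlgebra.toDirectSum_ofDirectSum (DirectSum.of (fun n => ⨂[F]^n M) n z)]
    congr 1
    exact (DirectSum.toAddMonoid_of
      (fun _ => LinearMap.toAddMonoidHom TensorPower.toTensorAlgebra) _ _).symm
  exact DirectSum.of_injective (β := fun n => ⨂[F]^n M) n (by rw [← key, ← key, h])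

end TensorAlgebra

section Transfer

/-- The canonical map `V^{⊗n} → T(V)`. -/
def tpToAlg : ∀ n : ℕ, ↥(TP k V n) →ₗ[k] TensorAlgebra k V
  | 0 => Algebra.linearMap k (TensorAlgebra k V)
  | 1 => (TensorAlgebra.ι k : V →ₗ[k] TensorAlgebra k V)
  | (n + 2) => LinearMap.mul' k (TensorAlgebra k V) ∘ₗ
      TensorProduct.map (tpToAlg (n + 1)) (TensorAlgebra.ι k)

theorem tpToAlg_stepEquiv (n : ℕ) (x : ↥(TP k V n)) (v : V) :
    tpToAlg k V (n + 1) (stepEquiv k V n (x ⊗ₜ v)) = tpToAlg k V n x * TensorAlgebra.ι k v := by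
  cases n with
  | zero =>
    have h : ∀ c : k, TensorAlgebra.ι k (c • v) =
        algebraMap k (TensorAlgebra k V) c * TensorAlgebra.ι k v := fun c => by
      rw [map_smul, Algebra.smul_def]
    exact h x
  | succ n => rfl

theorem tp_succ_induction {n : ℕ} {P : ↥(TP k V (n + 1)) → Prop} (h0 : P 0)
    (hadd : ∀ x y, P x → P y → P (x + y)) (hstep : ∀ x v, P (stepEquiv k V n (x ⊗ₜ v)))
    (z : ↥(TP k V (n + 1))) : P z := by
  obtain ⟨w, rfl⟩ := (stepEquiv k V n).surjective z
  induction w with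
  | zero => rwa [map_zero]
  | add a b ha hb => rw [map_add]; exact hadd _ _ ha hb
  | tmul x v => exact hstep x v

theorem tpToAlg_concatEquiv_tmul (p q : ℕ) (x : ↥(TP k V p)) (y : ↥(TP k V q)) :
    tpToAlg k V (p + q) (concatEquiv k V p q (x ⊗ₜ y)) = tpToAlg k V p x * tpToAlg k V q y := by
  induction q using Nat.twoStepInduction with
  | zero =>
    have h : ∀ c : k, tpToAlg k V p (c • x) =
        tpToAlg k V p x * algebraMap k (TensorAlgebra k V) c := fun c => by
      rw [map_smul, Algebra.smul_def, Algebra.commutes]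
    exact h y
  | one => exact tpToAlg_stepEquiv k V p x y
  | more q _ ih =>
    induction y using tp_succ_induction with
    | h0 => simp
    | hadd a b ha hb => rw [TensorProduct.tmul_add, map_add, map_add, map_add, ha, hb, mul_add]
    | hstep y v =>
      refine (tpToAlg_stepEquiv k V (p + (q + 1)) (concatEquiv k V p (q + 1) (x ⊗ₜ y)) v).trans ?_
      rw [ih, tpToAlg_stepEquiv, mul_assoc]

theorem tpToAlg_concatEquiv (p q : ℕ) (z : ↥(TP k V p) ⊗[k] ↥(TP k V q)) :
    tpToAlg k V (p + q) (concatEquiv k V p q z) = LinearMap.mul' k (TensorAlgebra k V)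
      (TensorProduct.map (tpToAlg k V p) (tpToAlg k V q) z) := by
  induction z with
  | zero => simp
  | add a b ha hb => simp only [map_add, ha, hb]
  | tmul x y => exact tpToAlg_concatEquiv_tmul k V p q x y

/-- The identification of `TP k V n` with Mathlib's tensor power. -/
def tpEquiv : ∀ n : ℕ, ↥(TP k V n) ≃ₗ[k] ⨂[k]^n V
  | 0 => TensorPower.algebraMap₀
  | 1 => (PiTensorProduct.subsingletonEquiv (0 : Fin 1) : (⨂[k]^1 V) ≃ₗ[k] V).symm
  | (n + 2) => (TensorProduct.congr (tpEquiv (n + 1))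
      (PiTensorProduct.subsingletonEquiv (0 : Fin 1)).symm).trans TensorPower.mulEquiv

theorem toTensorAlgebra_tpEquiv (n : ℕ) (x : ↥(TP k V n)) :
    TensorPower.toTensorAlgebra (tpEquiv k V n x) = tpToAlg k V n x := by
  have h1 : ∀ v : V, TensorPower.toTensorAlgebra
      ((PiTensorProduct.subsingletonEquiv (0 : Fin 1) : (⨂[k]^1 V) ≃ₗ[k] V).symm v) =
        TensorAlgebra.ι k v := fun v => by
    simp
  induction n using Nat.twoStepInduction with
  | zero => exact TensorPower.toTensorAlgebra_galgebra_toFun (R := k) (M := V) x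
  | one => exact h1 x
  | more n _ ih =>
    induction x using tp_succ_induction with
    | h0 => rw [map_zero, map_zero, map_zero]
    | hadd a b ha hb => rw [map_add, map_add, map_add, ha, hb]
    | hstep x v =>
      refine (TensorPower.toTensorAlgebra_gMul (tpEquiv k V (n + 1) x) _).trans ?_
      rw [ih, tpToAlg_stepEquiv]
      exact congrArg _ (h1 v)

theorem tpToAlg_injective (n : ℕ) : Function.Injective (tpToAlg k V n) := by
  intro x y h
  rw [← toTensorAlgebra_tpEquiv, ← toTensorAlgebra_tpEquiv] at h
  exact (tpEquiv k V n).injective (TensorPower.toTensorAlgebra_injective n h)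

/-- The subspace of `T(V)` corresponding to a subspace of `V^{⊗n}`. -/
def algSub {n : ℕ} (S : Submodule k ↥(TP k V n)) : Submodule k (TensorAlgebra k V) :=
  S.map (tpToAlg k V n)

theorem algSub_castTP {m n : ℕ} (h : m = n) (S : Submodule k ↥(TP k V m)) :
    algSub k V (castTP k V h S) = algSub k V S := by
  subst h; rfl

theorem algSub_concatSub {p q : ℕ} (S : Submodule k ↥(TP k V p)) (T : Submodule k ↥(TP k V q)) :
    algSub k V (concatSub k V S T) = algSub k V S * algSub k V T := by
  have h : tpToAlg k V (p + q) ∘ₗ (concatEquiv k V p q).toLinearMap =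
      LinearMap.mul' k (TensorAlgebra k V) ∘ₗ
        TensorProduct.map (tpToAlg k V p) (tpToAlg k V q) :=
    LinearMap.ext (tpToAlg_concatEquiv k V p q)
  rw [algSub, concatSub, ← Submodule.map_comp, h, Submodule.map_comp, ← LinearMap.range_comp,
    ← TensorProduct.map_comp, ← LinearMap.range_comp]
  apply le_antisymm
  · rintro _ ⟨z, rfl⟩
    induction z with
    | zero => simp
    | add a b ha hb => rw [map_add]; exact add_mem ha hb
    | tmul x y =>
      exact Submodule.mul_mem_mul (Submodule.mem_map_of_mem x.2) (Submodule.mem_map_of_mem y.2)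
  · refine Submodule.mul_le.2 ?_
    rintro _ ⟨x, hx, rfl⟩ _ ⟨y, hy, rfl⟩
    exact ⟨⟨x, hx⟩ ⊗ₜ ⟨y, hy⟩, rfl⟩

theorem algSub_injective (n : ℕ) : Function.Injective (algSub k V (n := n)) :=
  Submodule.map_injective_of_injective (tpToAlg_injective k V n)

theorem algSub_inf {n : ℕ} (S T : Submodule k ↥(TP k V n)) :
    algSub k V (S ⊓ T) = algSub k V S ⊓ algSub k V T :=
  Submodule.map_inf _ (tpToAlg_injective k V n)

theorem algSub_sup {n : ℕ} (S T : Submodule k ↥(TP k V n)) :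
    algSub k V (S ⊔ T) = algSub k V S ⊔ algSub k V T :=
  Submodule.map_sup _ _ _

theorem algSub_bot (n : ℕ) : algSub k V (⊥ : Submodule k ↥(TP k V n)) = ⊥ := Submodule.map_bot _

/-- The generating space of the tensor algebra. -/
abbrev tensorGen : Submodule k (TensorAlgebra k V) := LinearMap.range (TensorAlgebra.ι k (M := V))

theorem algSub_top (n : ℕ) : algSub k V (⊤ : Submodule k ↥(TP k V n)) = tensorGen k V ^ n := by
  rw [algSub, Submodule.map_top]
  induction n using Nat.twoStepInduction with
  | zero => rw [pow_zero, Submodule.one_eq_range]; rfl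
  | one => rw [pow_one]; rfl
  | more n _ ih =>
    rw [pow_succ, ← ih]
    apply le_antisymm
    · rintro _ ⟨z, rfl⟩
      induction z using tp_succ_induction with
      | h0 => rw [map_zero]; exact zero_mem _
      | hadd a b ha hb => rw [map_add]; exact add_mem ha hb
      | hstep x v =>
        rw [tpToAlg_stepEquiv]
        exact Submodule.mul_mem_mul ⟨x, rfl⟩ ⟨v, rfl⟩
    · refine Submodule.mul_le.2 ?_
      rintro _ ⟨x, rfl⟩ _ ⟨y, rfl⟩
      exact ⟨stepEquiv k V (n + 1) (x ⊗ₜ y), tpToAlg_stepEquiv k V (n + 1) x y⟩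

theorem tensorGen_pow_linearDisjoint (p q : ℕ) :
    (tensorGen k V ^ p).LinearDisjoint (tensorGen k V ^ q) := by
  have hr : ∀ n, LinearMap.range (tpToAlg k V n) = tensorGen k V ^ n := fun n => by
    rw [← algSub_top, algSub, Submodule.map_top]
  rw [← hr, ← hr]
  refine ⟨?_⟩
  let e : ∀ n, ↥(TP k V n) ≃ₗ[k] LinearMap.range (tpToAlg k V n) := fun n =>
    LinearEquiv.ofInjective _ (tpToAlg_injective k V n)
  have h : ∀ z, Submodule.mulMap (LinearMap.range (tpToAlg k V p))
      (LinearMap.range (tpToAlg k V q)) (TensorProduct.congr (e p) (e q) z) =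
        tpToAlg k V (p + q) (concatEquiv k V p q z) := fun z => by
    rw [tpToAlg_concatEquiv]
    induction z with
    | zero => simp
    | add a b ha hb => simp only [map_add, ha, hb]
    | tmul x y => rfl
  have hinj := (tpToAlg_injective k V (p + q)).comp (concatEquiv k V p q).injective
  intro x y hxy
  obtain ⟨x, rfl⟩ := (TensorProduct.congr (e p) (e q)).surjective x
  obtain ⟨y, rfl⟩ := (TensorProduct.congr (e p) (e q)).surjective y
  rw [h, h] at hxy
  rw [hinj hxy]

theorem algSub_le {n : ℕ} (S : Submodule k ↥(TP k V n)) : algSub k V S ≤ tensorGen k V ^ n := by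
  rw [← algSub_top]; exact Submodule.map_mono le_top

theorem algSub_relTerm (i j : ℕ) : algSub k V (relTerm k V R i j) =
    tensorGen k V ^ i * algSub k V R * tensorGen k V ^ j := by
  rw [relTerm, algSub_castTP, algSub_concatSub, algSub_concatSub, algSub_top, algSub_top,
    mul_assoc]

theorem algSub_RelOf (d : ℕ) : algSub k V (RelOf k V R d) =
    relSup (tensorGen k V) (algSub k V R) d (Finset.range (d - 1)) := by
  rw [RelOf, algSub, Submodule.map_iSup, relSup, Finset.sup_eq_iSup]
  simp_rw [Finset.mem_range, iSup_subtype', ← Fin.equivSubtype.iSup_comp]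
  exact iSup_congr fun i => (algSub_castTP k V _ _).trans (algSub_relTerm k V R _ _)

theorem algSub_Dual (d : ℕ) : algSub k V (Dual k V R d) =
    relInf (tensorGen k V) (algSub k V R) d (Finset.range (d - 1)) := by
  rw [Dual, ← Finset.inf_univ_eq_iInf, relInf]
  have h : ∀ s : Finset (Fin (d - 1)), algSub k V (n := d) (s.inf fun i =>
      castTP k V (by have := i.isLt; omega) (relTerm k V R i (d - 2 - i))) =
        tensorGen k V ^ d ⊓ s.inf fun i => relPow (tensorGen k V) (algSub k V R) d i := fun s => by
    induction s using Finset.induction_on with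
    | empty => rw [Finset.inf_empty, Finset.inf_empty, algSub_top, inf_top_eq]
    | insert i s _ ih =>
      rw [Finset.inf_insert, Finset.inf_insert, algSub_inf, ih, algSub_castTP, algSub_relTerm,
        inf_left_comm]
      rfl
  rw [h]
  congr 1
  rw [← Nat.Iio_eq_range, ← Fin.map_valEmbedding_univ, Finset.inf_map]
  rfl

section Terms

variable {ρ d : ℕ}

theorem algSub_Kt (h : d ≤ ρ) : algSub k V (Kt k V R ρ d) =
    relInf (tensorGen k V) (algSub k V R) ρ (Finset.range (d - 1)) := by
  rw [Kt, dif_pos h, algSub_castTP, algSub_concatSub, algSub_Dual, algSub_top,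
    relInf_mul_pow (tensorGen_pow_linearDisjoint k V) (algSub_le k V R)
      (fun i hi => by rw [Finset.mem_range] at hi; omega), Nat.add_sub_cancel' h]

theorem algSub_KtL (h : d ≤ ρ) : algSub k V (KtL k V R ρ d) =
    relInf (tensorGen k V) (algSub k V R) ρ (Finset.Ico (ρ - d) (ρ - 1)) := by
  rw [KtL, dif_pos h, algSub_castTP, algSub_concatSub, algSub_Dual, algSub_top,
    pow_mul_relInf (tensorGen_pow_linearDisjoint k V) (algSub_le k V R) _
      (fun i hi => by rw [Finset.mem_range] at hi; omega), Nat.sub_add_cancel h,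
    Finset.range_eq_Ico, Finset.image_add_left_Ico]
  congr 1
  ext i
  simp only [Finset.mem_Ico]
  omega

theorem algSub_Kr (h : d ≤ ρ) : algSub k V (Kr k V R ρ d) =
    relInf (tensorGen k V) (algSub k V R) ρ (Finset.range (d - 1)) ⊓
      relSup (tensorGen k V) (algSub k V R) ρ (Finset.Ico d (ρ - 1)) := by
  have hW := tensorGen_pow_linearDisjoint k V
  rw [Kr, dif_pos h, algSub_castTP, algSub_concatSub, algSub_Dual, algSub_RelOf,
    (hW d (ρ - d)).mul_eq_inf relInf_le
      (relSup_le (algSub_le k V R) fun i hi => by rw [Finset.mem_range] at hi; omega),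
    relInf_mul_pow hW (algSub_le k V R) (fun i hi => by rw [Finset.mem_range] at hi; omega),
    pow_mul_relSup, Nat.add_sub_cancel' h, Finset.range_eq_Ico (ρ - d - 1),
    Finset.image_add_left_Ico]
  congr 2
  ext i
  simp only [Finset.mem_Ico]
  omega

theorem algSub_KrL (h : d ≤ ρ) : algSub k V (KrL k V R ρ d) =
    relInf (tensorGen k V) (algSub k V R) ρ (Finset.Ico (ρ - d) (ρ - 1)) ⊓
      relSup (tensorGen k V) (algSub k V R) ρ (Finset.range (ρ - d - 1)) := by
  have hW := tensorGen_pow_linearDisjoint k V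
  rw [← algSub_KtL k V R h, KtL, KrL, dif_pos h, dif_pos h, algSub_castTP, algSub_castTP,
    algSub_concatSub, algSub_concatSub, algSub_RelOf, algSub_top,
    (hW (ρ - d) d).mul_eq_inf
      (relSup_le (algSub_le k V R) fun i hi => by rw [Finset.mem_range] at hi; omega)
      (algSub_le k V _),
    relSup_mul_pow (fun i hi => by rw [Finset.mem_range] at hi; omega), Nat.sub_add_cancel h,
    inf_comm]

theorem Kr_eq_bot (h : d ≤ ρ) (h' : ρ ≤ d + 1) : Kr k V R ρ d = ⊥ :=
  algSub_injective k V ρ <| by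
    rw [algSub_Kr k V R h, Finset.Ico_eq_empty (by omega), relSup, Finset.sup_empty, inf_bot_eq,
      algSub_bot]

theorem KrL_eq_bot (h : d ≤ ρ) (h' : ρ ≤ d + 1) : KrL k V R ρ d = ⊥ :=
  algSub_injective k V ρ <| by
    rw [algSub_KrL k V R h, Nat.sub_eq_zero_of_le (by omega : ρ - d ≤ 1), Finset.range_zero,
      relSup, Finset.sup_empty, inf_bot_eq, algSub_bot]

theorem Kt_eq_top (h : d ≤ ρ) (h' : d ≤ 1) : Kt k V R ρ d = ⊤ :=
  algSub_injective k V ρ <| by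
    rw [algSub_Kt k V R h, Nat.sub_eq_zero_of_le h', Finset.range_zero, relInf_empty, algSub_top]

theorem KtL_eq_top (h : d ≤ ρ) (h' : d ≤ 1) : KtL k V R ρ d = ⊤ :=
  algSub_injective k V ρ <| by
    rw [algSub_KtL k V R h, Finset.Ico_eq_empty (by omega), relInf_empty, algSub_top]

theorem isKoszul_iff : IsKoszul k V R ↔ ∀ n c, c + 2 ≤ n →
    RelDistrib (tensorGen k V) (algSub k V R) n (Finset.range c) c
      (Finset.Ico (c + 1) (n - 1)) := by
  have hmid : ∀ ρ c, c + 2 ≤ ρ → (RelDistrib (tensorGen k V) (algSub k V R) ρ (Finset.range c) c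
      (Finset.Ico (c + 1) (ρ - 1)) ↔
      Kt k V R ρ (c + 1) ⊓ Kr k V R ρ c = Kr k V R ρ (c + 1) ⊔ Kt k V R ρ (c + 1 + 1)) := by
    intro ρ c h
    rw [← (algSub_injective k V ρ).eq_iff, algSub_inf, algSub_sup, algSub_Kt k V R (by omega),
      algSub_Kr k V R (by omega), algSub_Kr k V R (by omega), algSub_Kt k V R (by omega),
      ← inf_assoc, inf_eq_left.2 (relInf_anti (Finset.range_subset_range.2 (by omega))),
      ← Finset.insert_Ico_add_one_left_eq_Ico (show c < ρ - 1 by omega), relSup,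
      Finset.sup_insert, Nat.add_sub_cancel, Nat.add_sub_cancel, Finset.range_add_one,
      relInf_insert]
    exact inf_sup_eq_iff_distribTriple.symm
  refine ⟨fun h n c hc => (hmid n c hc).2 (h n (by omega) (c + 1) (by omega)),
    fun h ρ hρ d hd => ?_⟩
  rcases Nat.eq_zero_or_pos d with rfl | hd0
  · rw [if_pos rfl, Kt_eq_top k V R hd zero_le_one, Kt_eq_top k V R hρ le_rfl, inf_top_eq,
      sup_top_eq]
  obtain ⟨c, rfl⟩ : ∃ c, d = c + 1 := ⟨d - 1, by omega⟩
  rw [if_neg hd0.ne', Nat.add_sub_cancel]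
  rcases hd.eq_or_lt with rfl | hlt
  · rw [Kr_eq_bot k V R (by omega) le_rfl, Kr_eq_bot k V R le_rfl (by omega),
      inf_bot_eq, bot_sup_eq, Kt, dif_neg (Nat.not_succ_le_self (c + 1))]
  · exact (hmid ρ c hlt).1 (h ρ c hlt)

theorem isKoszulLeft_iff : IsKoszulLeft k V R ↔ ∀ n c, c + 2 ≤ n →
    RelDistrib (tensorGen k V) (algSub k V R) n (Finset.Ico (c + 1) (n - 1)) c
      (Finset.range c) := by
  have hmid : ∀ d c, (RelDistrib (tensorGen k V) (algSub k V R) (c + 1 + (d + 1))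
      (Finset.Ico (c + 1) (c + 1 + (d + 1) - 1)) c (Finset.range c) ↔
      KtL k V R (c + 1 + (d + 1)) (d + 1) ⊓ KrL k V R (c + 1 + (d + 1)) d =
        KrL k V R (c + 1 + (d + 1)) (d + 1) ⊔ KtL k V R (c + 1 + (d + 1)) (d + 1 + 1)) := by
    intro d c
    rw [← (algSub_injective k V _).eq_iff, algSub_inf, algSub_sup, algSub_KtL k V R (by omega),
      algSub_KrL k V R (by omega), algSub_KrL k V R (by omega), algSub_KtL k V R (by omega),
      ← inf_assoc, inf_eq_left.2 (relInf_anti (Finset.Ico_subset_Ico_left (by omega))),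
      show c + 1 + (d + 1) - (d + 1) = c + 1 by omega,
      show c + 1 + (d + 1) - d - 1 = c + 1 by omega,
      show c + 1 + (d + 1) - (d + 1 + 1) = c by omega, Nat.add_sub_cancel c,
      ← Finset.insert_Ico_add_one_left_eq_Ico (show c < c + 1 + (d + 1) - 1 by omega),
      Finset.range_add_one, relSup, relSup, Finset.sup_insert, relInf_insert]
    exact inf_sup_eq_iff_distribTriple.symm
  constructor
  · intro h n c hc
    obtain ⟨d, rfl⟩ : ∃ d, n = c + 1 + (d + 1) := ⟨n - c - 2, by omega⟩
    exact (hmid d c).2 (h _ (by omega) (d + 1) (by omega))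
  · intro h ρ hρ d hd
    rcases Nat.eq_zero_or_pos d with rfl | hd0
    · rw [if_pos rfl, KtL_eq_top k V R hd zero_le_one, KtL_eq_top k V R hρ le_rfl, inf_top_eq,
        sup_top_eq]
    obtain ⟨d, rfl⟩ : ∃ e, d = e + 1 := ⟨d - 1, by omega⟩
    rw [if_neg hd0.ne', Nat.add_sub_cancel]
    rcases hd.eq_or_lt with rfl | hlt
    · rw [KrL_eq_bot k V R (by omega) le_rfl, KrL_eq_bot k V R le_rfl (by omega),
        inf_bot_eq, bot_sup_eq, KtL, dif_neg (Nat.not_succ_le_self (d + 1))]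
    · obtain ⟨c, rfl⟩ : ∃ c, ρ = c + 1 + (d + 1) := ⟨ρ - d - 2, by omega⟩
      exact (hmid d c).1 (h _ c (by omega))

end Terms

end Transfer

/-- **Left and right Koszul complexes.**  The Koszul complex of `A = T(V)/(R)` in weight `ρ` is
exact for every `ρ ≥ 1` if and only if the left Koszul complex of `A` in weight `ρ` is exact for
every `ρ ≥ 1`. -/
theorem statement6 (R : Submodule k ↥(TP k V 2)) :
    IsKoszul k V R ↔ IsKoszulLeft k V R := by
  rw [isKoszul_iff, isKoszulLeft_iff]
  exact relDistrib_range_iff (tensorGen_pow_linearDisjoint k V) (algSub_le k V R)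

end Quadratic
end
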